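/- Let (A_1,…,A_ℓ) be invertible 2×2 real matrices, and suppose the cocycle is k-quasi-multiplicative: there exists c > 0 such that for all finite words I, J there exists a word K of length exactly k with ‖A_{IKJ}‖ ≥ c ‖A_I‖ ‖A_J‖. Then for every s ∈ [0,2] there exists C > 0 such that for all finite words I, J there exists a word K of length exactly k with φ^s(A_{IKJ}) ≥ C φ^s(A_I) φ^s(A_J). -/

import Mathlib

open Matrix

/-- For a word `I = [i₀, i₁, …, i_{n-1}]`, the cocycle product
`A_I = A_{i_{n-1}} ⋯ A_{i₀}`. -/
noncomputable def wordProd {ℓ d : ℕ} (A : Fin ℓ → Matrix (Fin d) (Fin d) ℝ)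
    (I : List (Fin ℓ)) : Matrix (Fin d) (Fin d) ℝ :=
  I.foldl (fun B i => A i * B) 1

/-- The operator norm of a matrix, viewed as a linear operator on Euclidean space. -/
noncomputable def opNorm {d : ℕ} (M : Matrix (Fin d) (Fin d) ℝ) : ℝ :=
  ‖Matrix.toEuclideanCLM (𝕜 := ℝ) M‖

/-- The singular value function `φ^s` on `2 × 2` matrices. -/
noncomputable def phi (s : ℝ) (M : Matrix (Fin 2) (Fin 2) ℝ) : ℝ :=
  if s < 1 then opNorm M ^ s
  else if s < 2 then opNorm M * opNorm M⁻¹ ^ (-(s - 1))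
  else |M.det| ^ (s / 2)

section Helpers

variable {ℓ d : ℕ} (A : Fin ℓ → Matrix (Fin d) (Fin d) ℝ)

theorem foldl_mul_eq_wordProd_mul (I : List (Fin ℓ)) (B : Matrix (Fin d) (Fin d) ℝ) :
    I.foldl (fun B i => A i * B) B = wordProd A I * B := by
  induction I generalizing B with
  | nil => simp [wordProd]
  | cons i I ih =>
    rw [wordProd, List.foldl_cons, List.foldl_cons, ih, ih (A i * 1), Matrix.mul_one,
      Matrix.mul_assoc]

theorem wordProd_append (I J : List (Fin ℓ)) :
    wordProd A (I ++ J) = wordProd A J * wordProd A I := by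
  conv_lhs => rw [wordProd, List.foldl_append, foldl_mul_eq_wordProd_mul]
  rfl

theorem wordProd_cons (i : Fin ℓ) (I : List (Fin ℓ)) :
    wordProd A (i :: I) = wordProd A I * A i := by
  rw [wordProd, List.foldl_cons, foldl_mul_eq_wordProd_mul, Matrix.mul_one]

theorem det_wordProd_ne_zero (hA : ∀ i, IsUnit (A i)) (I : List (Fin ℓ)) :
    (wordProd A I).det ≠ 0 := by
  induction I with
  | nil => simp [wordProd]
  | cons i I ih =>
    rw [wordProd_cons, Matrix.det_mul]
    exact mul_ne_zero ih ((Matrix.isUnit_iff_isUnit_det _).1 (hA i)).ne_zero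

end Helpers

open scoped Matrix.Norms.L2Operator in
theorem opNorm_eq_norm {d : ℕ} (M : Matrix (Fin d) (Fin d) ℝ) : opNorm M = ‖M‖ := rfl

theorem opNorm_nonneg {d : ℕ} (M : Matrix (Fin d) (Fin d) ℝ) : 0 ≤ opNorm M := norm_nonneg _

open scoped Matrix.Norms.L2Operator in
theorem opNorm_pos {M : Matrix (Fin 2) (Fin 2) ℝ} (hM : M.det ≠ 0) : 0 < opNorm M := by
  rw [opNorm_eq_norm, norm_pos_iff]
  rintro rfl
  simp at hM

open scoped Matrix.Norms.L2Operator in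
/-- In dimension two the adjugate is an orthogonal conjugate of the transpose. -/
theorem opNorm_adjugate (M : Matrix (Fin 2) (Fin 2) ℝ) : opNorm M.adjugate = opNorm M := by
  let J : Matrix (Fin 2) (Fin 2) ℝ := !![0, 1; -1, 0]
  have hJ : J ∈ unitary (Matrix (Fin 2) (Fin 2) ℝ) := by
    rw [Unitary.mem_iff]
    constructor <;> ext i j <;> fin_cases i <;> fin_cases j <;>
      simp [J, Matrix.mul_apply, Matrix.star_apply]
  have h : M.adjugate = J * Mᴴ * star J := by
    ext i j
    fin_cases i <;> fin_cases j <;>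
      simp [J, Matrix.mul_apply, Matrix.star_apply, Matrix.adjugate_fin_two, Matrix.vecMul, dotProduct]
  rw [opNorm_eq_norm, opNorm_eq_norm, h,
    CStarRing.norm_mul_mem_unitary _ (Unitary.star_mem hJ),
    CStarRing.norm_mem_unitary_mul _ hJ, Matrix.l2_opNorm_conjTranspose]

open scoped Matrix.Norms.L2Operator in
theorem opNorm_inv {M : Matrix (Fin 2) (Fin 2) ℝ} :
    opNorm M⁻¹ = opNorm M / |M.det| := by
  rw [opNorm_eq_norm, Matrix.inv_def, norm_smul, ← opNorm_eq_norm, opNorm_adjugate,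
    Ring.inverse_eq_inv', norm_inv, Real.norm_eq_abs, inv_mul_eq_div]

theorem exists_phi_eq {s : ℝ} (h0 : 0 ≤ s) (h2 : s ≤ 2) :
    ∃ a b : ℝ, 0 ≤ a ∧ ∀ M : Matrix (Fin 2) (Fin 2) ℝ, M.det ≠ 0 →
      phi s M = opNorm M ^ a * |M.det| ^ b := by
  rcases lt_or_ge s 1 with h1 | h1
  · exact ⟨s, 0, h0, fun M _ => by simp [phi, h1]⟩
  rcases h2.lt_or_eq with h2 | rfl
  · refine ⟨2 - s, s - 1, by linarith, fun M hM => ?_⟩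
    have hn := opNorm_pos hM
    have hd := abs_pos.2 hM
    rw [phi, if_neg h1.not_gt, if_pos h2, opNorm_inv, Real.div_rpow hn.le hd.le,
      Real.rpow_neg hd.le, div_inv_eq_mul, ← mul_assoc]
    congr 1
    rw [show 2 - s = 1 + -(s - 1) by ring, Real.rpow_add hn, Real.rpow_one]
  · exact ⟨0, 1, le_rfl, fun M _ => by norm_num [phi]⟩

theorem singular_value_function_quasi_multiplicative
    (ℓ : ℕ) (hℓ : 2 ≤ ℓ)
    (A : Fin ℓ → Matrix (Fin 2) (Fin 2) ℝ) (hA : ∀ i, IsUnit (A i))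
    (k : ℕ) (c : ℝ) (hc : 0 < c)
    (hqm : ∀ I J : List (Fin ℓ), ∃ K : List (Fin ℓ), K.length = k ∧
      opNorm (wordProd A (I ++ K ++ J)) ≥ c * opNorm (wordProd A I) * opNorm (wordProd A J)) :
    ∀ s : ℝ, 0 ≤ s → s ≤ 2 → ∃ C : ℝ, 0 < C ∧
      ∀ I J : List (Fin ℓ), ∃ K : List (Fin ℓ), K.length = k ∧
        phi s (wordProd A (I ++ K ++ J)) ≥ C * phi s (wordProd A I) * phi s (wordProd A J) := by
  intro s h0 h2
  obtain ⟨a, b, ha, hphi⟩ := exists_phi_eq h0 h2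
  have hdet := det_wordProd_ne_zero A hA
  obtain ⟨K₁, hK₁, -⟩ := hqm [] []
  obtain ⟨K₀, -, hmin⟩ := Set.exists_min_image {K : List (Fin ℓ) | K.length = k}
    (fun K => |(wordProd A K).det| ^ b) (List.finite_length_eq _ k) ⟨K₁, hK₁⟩
  refine ⟨c ^ a * |(wordProd A K₀).det| ^ b,
    mul_pos (Real.rpow_pos_of_pos hc a) (Real.rpow_pos_of_pos (abs_pos.2 (hdet K₀)) b),
    fun I J => ?_⟩
  obtain ⟨K, hK, hn⟩ := hqm I J
  refine ⟨K, hK, ?_⟩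
  rw [hphi _ (hdet _), hphi _ (hdet _), hphi _ (hdet _)]
  have hI := opNorm_nonneg (wordProd A I)
  have hJ := opNorm_nonneg (wordProd A J)
  have hnorm := Real.rpow_le_rpow (by positivity) hn ha
  rw [Real.mul_rpow (by positivity) hJ, Real.mul_rpow hc.le hI] at hnorm
  have hdetK : |(wordProd A (I ++ K ++ J)).det| ^ b =
      |(wordProd A K).det| ^ b * (|(wordProd A I).det| ^ b * |(wordProd A J).det| ^ b) := by
    rw [wordProd_append, wordProd_append, Matrix.det_mul, Matrix.det_mul, abs_mul, abs_mul,
      Real.mul_rpow (by positivity) (by positivity), Real.mul_rpow (by positivity) (by positivity)]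
    ring
  rw [hdetK, ge_iff_le]
  calc _ = c ^ a * opNorm (wordProd A I) ^ a * opNorm (wordProd A J) ^ a *
        (|(wordProd A K₀).det| ^ b *
          (|(wordProd A I).det| ^ b * |(wordProd A J).det| ^ b)) := by ring
    _ ≤ _ := mul_le_mul hnorm (mul_le_mul_of_nonneg_right (hmin K hK) (by positivity))
        (by positivity) (Real.rpow_nonneg (opNorm_nonneg _) a)
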